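/- arXiv:1209.5791 — 3 statements merged into one kernel-verified Lean document; each statement's English description precedes it below -/
import Mathlib

section
/- Let M be a finite matroid on the ground set {0,1,…,m−1} in which every singleton set is independent (M has no loops). For each index k, define the independence time τ(k) to be the least index i with 0 ≤ i ≤ k such that rank({i,…,k}) > rank({i,…,k−1}) (where {i,…,k−1} denotes the empty set when i = k). Then τ(k) is well defined for every k, and for all 0 ≤ i ≤ j ≤ m−1 the rank of the slice {i,…,j} equals the number of indices k with i ≤ k ≤ j and τ(k) ≤ i. -/
/-- The rank of a set in a matroid: the maximum cardinality of an independent subset. -/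
noncomputable def matroidRank {α : Type*} (M : Matroid α) (X : Set α) : ℕ :=
  sSup {n | ∃ A, A ⊆ X ∧ M.Indep A ∧ A.ncard = n}

/-- The independence time of index `k`: the least `i ≤ k` such that adding `e_k`
to the slice `{i, …, k−1}` increases the rank. -/
noncomputable def indepTime (M : Matroid ℕ) (k : ℕ) : ℕ :=
  sInf {i | i ≤ k ∧ matroidRank M (Set.Icc i k) > matroidRank M (Set.Ico i k)}

theorem matroidRank_eq_eRk {α : Type*} (M : Matroid α) {X : Set α} (hX : X.Finite) :
    (matroidRank M X : ℕ∞) = M.eRk X := by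
  obtain ⟨I, hI⟩ := M.exists_isBasis' X
  have hIfin : I.Finite := hX.subset hI.subset
  have hgreatest : IsGreatest {n | ∃ A, A ⊆ X ∧ M.Indep A ∧ A.ncard = n} I.ncard := by
    refine ⟨⟨I, hI.subset, hI.indep, rfl⟩, ?_⟩
    rintro n ⟨A, hAX, hA, rfl⟩
    have h : A.encard ≤ I.encard := by
      rw [hI.encard_eq_eRk, ← hA.eRk_eq_encard]
      exact M.eRk_mono hAX
    rw [← (hX.subset hAX).cast_ncard_eq, ← hIfin.cast_ncard_eq] at h
    exact_mod_cast h
  rw [matroidRank, hgreatest.csSup_eq, hIfin.cast_ncard_eq, hI.encard_eq_eRk]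

theorem matroidRank_empty {α : Type*} (M : Matroid α) : matroidRank M ∅ = 0 := by
  have h := matroidRank_eq_eRk M Set.finite_empty
  rw [Matroid.eRk_empty] at h
  exact_mod_cast h

theorem matroidRank_insert_of_notMem_closure {α : Type*} (M : Matroid α) {X : Set α} {e : α}
    (hX : X.Finite) (heE : e ∈ M.E) (he : e ∉ M.closure X) :
    matroidRank M (insert e X) = matroidRank M X + 1 := by
  have h := Matroid.eRk_insert_eq_add_one (M := M) (X := X) ⟨heE, he⟩
  rw [← matroidRank_eq_eRk M hX, ← matroidRank_eq_eRk M (hX.insert e)] at h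
  exact_mod_cast h

theorem matroidRank_insert_of_mem_closure {α : Type*} (M : Matroid α) {X : Set α} {e : α}
    (hX : X.Finite) (he : e ∈ M.closure X) :
    matroidRank M (insert e X) = matroidRank M X := by
  have h := M.eRk_insert_closure_eq e X
  rw [Set.insert_eq_of_mem he, M.eRk_closure_eq, ← matroidRank_eq_eRk M hX,
    ← matroidRank_eq_eRk M (hX.insert e)] at h
  exact_mod_cast h.symm

theorem matroidRank_lt_insert_iff {α : Type*} (M : Matroid α) {X : Set α} {e : α}
    (hX : X.Finite) (heE : e ∈ M.E) :
    matroidRank M X < matroidRank M (insert e X) ↔ e ∉ M.closure X := by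
  by_cases he : e ∈ M.closure X
  · simp [matroidRank_insert_of_mem_closure M hX he, he]
  · simp [matroidRank_insert_of_notMem_closure M hX heE he, he]

theorem matroidRank_Ico_lt_Icc_iff (M : Matroid ℕ) {i k : ℕ} (hik : i ≤ k) (hk : k ∈ M.E) :
    matroidRank M (Set.Ico i k) < matroidRank M (Set.Icc i k) ↔
      k ∉ M.closure (Set.Ico i k) := by
  rw [← Set.Ico_insert_right hik]
  exact matroidRank_lt_insert_iff M (Set.finite_Ico i k) hk

theorem matroidRank_Ico_self_lt_Icc_self (M : Matroid ℕ) {k : ℕ} (hk : M.Indep {k}) :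
    matroidRank M (Set.Ico k k) < matroidRank M (Set.Icc k k) := by
  rw [matroidRank_Ico_lt_Icc_iff M le_rfl (hk.subset_ground rfl), Set.Ico_self]
  exact (Matroid.indep_singleton.1 hk).not_isLoop

theorem indepTime_le_iff (M : Matroid ℕ) {i k : ℕ} (hik : i ≤ k) (hk : M.Indep {k}) :
    indepTime M k ≤ i ↔ k ∉ M.closure (Set.Ico i k) := by
  have hkE : k ∈ M.E := hk.subset_ground rfl
  constructor
  · intro h hmem
    have hne : {i | i ≤ k ∧
        matroidRank M (Set.Icc i k) > matroidRank M (Set.Ico i k)}.Nonempty :=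
      ⟨k, le_rfl, matroidRank_Ico_self_lt_Icc_self M hk⟩
    obtain ⟨hle, hlt⟩ : indepTime M k ≤ k ∧ matroidRank M (Set.Icc (indepTime M k) k) >
        matroidRank M (Set.Ico (indepTime M k) k) := Nat.sInf_mem hne
    exact (matroidRank_Ico_lt_Icc_iff M hle hkE).1 hlt
      (M.closure_subset_closure (Set.Ico_subset_Ico_left h) hmem)
  · exact fun h => Nat.sInf_le ⟨hik, (matroidRank_Ico_lt_Icc_iff M hik hkE).2 h⟩

theorem matroidRank_Ico_eq_ncard (M : Matroid ℕ) {i n : ℕ} (hin : i ≤ n)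
    (hM : ∀ k < n, M.Indep {k}) :
    matroidRank M (Set.Ico i n) = {k | i ≤ k ∧ k < n ∧ indepTime M k ≤ i}.ncard := by
  induction n, hin using Nat.le_induction with
  | base =>
    have h : {k | i ≤ k ∧ k < i ∧ indepTime M k ≤ i} = ∅ := by
      ext k
      simp only [Set.mem_ofPred_eq, Set.mem_empty_iff_false]
      grind
    rw [Set.Ico_self, matroidRank_empty, h, Set.ncard_empty]
  | succ n hin ih =>
    have ih := ih fun k hk => hM k (by omega)
    have hn : M.Indep {n} := hM n (by omega)
    have hIco : Set.Ico i (n + 1) = insert n (Set.Ico i n) := by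
      ext k
      simp only [Set.mem_Ico, Set.mem_insert_iff]
      omega
    rw [hIco]
    by_cases hmem : n ∈ M.closure (Set.Ico i n)
    · rw [matroidRank_insert_of_mem_closure M (Set.finite_Ico i n) hmem, ih]
      have htime : ¬ indepTime M n ≤ i := by simpa [indepTime_le_iff M hin hn] using hmem
      congr 1
      ext k
      simp only [Set.mem_ofPred_eq]
      grind
    · have htime : indepTime M n ≤ i := (indepTime_le_iff M hin hn).2 hmem
      have hset : {k | i ≤ k ∧ k < n + 1 ∧ indepTime M k ≤ i} =
          insert n {k | i ≤ k ∧ k < n ∧ indepTime M k ≤ i} := by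
        ext k
        simp only [Set.mem_ofPred_eq, Set.mem_insert_iff]
        grind
      rw [matroidRank_insert_of_notMem_closure M (Set.finite_Ico i n) (hn.subset_ground rfl) hmem,
        ih, hset, Set.ncard_insert_of_notMem (by simp)
          ((Set.finite_Ico i n).subset fun k hk => ⟨hk.1, hk.2.1⟩)]

theorem independence_time_wellDefined_and_slice_rank
    (m : ℕ) (M : Matroid ℕ) (hE : M.E = Set.Iio m)
    (hNoLoops : ∀ i < m, M.Indep {i}) :
    (∀ k < m, ∃ i, i ≤ k ∧
        matroidRank M (Set.Icc i k) > matroidRank M (Set.Ico i k)) ∧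
    (∀ i j, i ≤ j → j < m →
        matroidRank M (Set.Icc i j) =
          {k | i ≤ k ∧ k ≤ j ∧ indepTime M k ≤ i}.ncard) := by
  refine ⟨fun k hk => ⟨k, le_rfl, matroidRank_Ico_self_lt_Icc_self M (hNoLoops k hk)⟩,
    fun i j hij hj => ?_⟩
  have h := matroidRank_Ico_eq_ncard M (i := i) (n := j + 1) (by omega)
    fun k hk => hNoLoops k (by omega)
  simpa only [Nat.lt_succ_iff, Set.Ico, Set.Icc] using h
end

section
/- Let e_0, e_1, …, e_{m−1} be a sequence of unordered pairs of distinct vertices from a set V. Say that e_k is a triad closure event in the slice {i,…,j} if i ≤ k ≤ j and there exist indices a, b with i ≤ a < b < k such that the three edges e_a, e_b, e_k form a triangle, i.e., they are three distinct unordered pairs covering exactly three vertices, each pair of edges sharing a vertex. For each k, define Δ(k) to be the least index d with 0 ≤ d ≤ k such that no such pair a, b exists with d ≤ a < b < k. Then Δ(k) is well defined, and for all 0 ≤ i ≤ j ≤ m−1 the number of triad closure events in the slice {i,…,j} equals the number of indices k with i ≤ k ≤ j and Δ(k) > i. -/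
/-- Three unordered pairs form a triangle: they are pairwise distinct and there are
three distinct vertices `u, v, w` such that the three pairs are exactly
`{u,v}, {v,w}, {u,w}`. -/
def IsTriangle {V : Type*} (p q r : Sym2 V) : Prop :=
  p ≠ q ∧ p ≠ r ∧ q ≠ r ∧
    ∃ u v w : V, u ≠ v ∧ u ≠ w ∧ v ≠ w ∧
      ({p, q, r} : Set (Sym2 V)) = {s(u, v), s(v, w), s(u, w)}

/-- `Δ(k)`: the least `d ≤ k` such that no two edges `e_a, e_b` with
`d ≤ a < b < k` form a triangle together with `e_k`. -/
noncomputable def triadTime {V : Type*} (e : ℕ → Sym2 V) (k : ℕ) : ℕ :=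
  sInf {d | d ≤ k ∧ ¬ ∃ a b, d ≤ a ∧ a < b ∧ b < k ∧ IsTriangle (e a) (e b) (e k)}

theorem exists_le_no_triad {V : Type*} (e : ℕ → Sym2 V) (k : ℕ) :
    ∃ d, d ≤ k ∧ ¬ ∃ a b, d ≤ a ∧ a < b ∧ b < k ∧ IsTriangle (e a) (e b) (e k) :=
  ⟨k, le_rfl, fun ⟨_, _, hka, hab, hbk, _⟩ => by omega⟩

theorem lt_triadTime_iff {V : Type*} (e : ℕ → Sym2 V) {i k : ℕ} (hik : i ≤ k) :
    i < triadTime e k ↔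
      ∃ a b, i ≤ a ∧ a < b ∧ b < k ∧ IsTriangle (e a) (e b) (e k) := by
  constructor
  · intro h
    by_contra hne
    exact Nat.notMem_of_lt_sInf h ⟨hik, hne⟩
  · rintro ⟨a, b, hia, hab, hbk, ht⟩
    by_contra! hle
    exact (Nat.sInf_mem (exists_le_no_triad e k)).2 ⟨a, b, hle.trans hia, hab, hbk, ht⟩

theorem triad_closure_count
    {V : Type*} (m : ℕ) (e : ℕ → Sym2 V) (he : ∀ k < m, ¬ (e k).IsDiag) :
    (∀ k, ∃ d, d ≤ k ∧
        ¬ ∃ a b, d ≤ a ∧ a < b ∧ b < k ∧ IsTriangle (e a) (e b) (e k)) ∧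
    (∀ i j, i ≤ j → j < m →
        {k | i ≤ k ∧ k ≤ j ∧
            ∃ a b, i ≤ a ∧ a < b ∧ b < k ∧ IsTriangle (e a) (e b) (e k)}.ncard =
          {k | i ≤ k ∧ k ≤ j ∧ i < triadTime e k}.ncard) := by
  refine ⟨exists_le_no_triad e, fun i j _ _ => ?_⟩
  congr 1
  ext k
  exact and_congr_right fun hik => and_congr_right fun _ => (lt_triadTime_iff e hik).symm
end

section
/- Let n be a positive integer and let π be a permutation of {0, 1, …, n−1}. Define a sequence s_0, s_1, …, s_{2n−1} with values in {0, …, n−1} by s_t = n−1−t for 0 ≤ t ≤ n−1 and s_t = π⁻¹(t−n) for n ≤ t ≤ 2n−1. Then for all X, Y with 0 ≤ X, Y ≤ n−1, the number of indices i with i ≤ X and π(i) ≤ Y equals the number of values that occur twice among the entries s_t with n−1−X ≤ t ≤ n+Y. -/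
theorem dominance_to_repeated_edges
    (n : ℕ) (hn : 0 < n) (π : Equiv.Perm (Fin n))
    (s : ℕ → ℕ)
    (hs1 : ∀ t, t ≤ n - 1 → s t = n - 1 - t)
    (hs2 : ∀ t (h1 : n ≤ t) (h2 : t ≤ 2 * n - 1),
      s t = (π.symm ⟨t - n, by omega⟩ : Fin n))
    (X Y : ℕ) (hX : X ≤ n - 1) (hY : Y ≤ n - 1) :
    (Finset.univ.filter fun i : Fin n => (i : ℕ) ≤ X ∧ (π i : ℕ) ≤ Y).card =
      ((Finset.range n).filter fun v =>
        ((Finset.Icc (n - 1 - X) (n + Y)).filter fun t => s t = v).card = 2).card := by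
  have key : ∀ (i : Fin n) (t : ℕ), t ≤ 2 * n - 1 →
      (s t = i ↔ t = n - 1 - i ∨ t = n + π i) := by
    intro i t ht
    have hi := i.isLt
    rcases Nat.lt_or_ge t n with h | h
    · rw [hs1 t (by omega)]
      omega
    · rw [hs2 t h ht, Fin.val_inj, Equiv.symm_apply_eq, Fin.ext_iff]
      simp only
      omega
  have twice : ∀ i : Fin n,
      ((Finset.Icc (n - 1 - X) (n + Y)).filter fun t => s t = i).card = 2 ↔
        (i : ℕ) ≤ X ∧ (π i : ℕ) ≤ Y := by
    intro i
    have hi := i.isLt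
    have hsub : ((Finset.Icc (n - 1 - X) (n + Y)).filter fun t => s t = i) =
        ({n - 1 - (i : ℕ), n + (π i : ℕ)} : Finset ℕ).filter
          (· ∈ Finset.Icc (n - 1 - X) (n + Y)) := by
      ext t
      simp only [Finset.mem_filter, Finset.mem_insert, Finset.mem_singleton]
      rw [and_comm]
      refine and_congr_left fun ht => key i t ?_
      have := (Finset.mem_Icc.mp ht).2
      omega
    have hpair : ({n - 1 - (i : ℕ), n + (π i : ℕ)} : Finset ℕ).card = 2 :=
      Finset.card_pair (by omega)
    rw [hsub, ← hpair, Finset.card_filter_eq_iff]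
    simp only [Finset.mem_insert, Finset.mem_singleton, forall_eq_or_imp, forall_eq,
      Finset.mem_Icc]
    omega
  rw [← Finset.card_map Fin.valEmbedding]
  congr 1
  ext v
  simp only [Finset.mem_map, Finset.mem_filter, Finset.mem_univ, true_and, Finset.mem_range,
    Fin.valEmbedding_apply]
  constructor
  · rintro ⟨i, h, rfl⟩
    exact ⟨i.isLt, (twice i).mpr h⟩
  · rintro ⟨hv, h⟩
    exact ⟨⟨v, hv⟩, (twice ⟨v, hv⟩).mp h, rfl⟩
end
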